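/- Let U₁ be a strictly convex domain in ℝⁿ (n ≥ 2), and let U₂ ⊆ ℝⁿ be any domain whose closure is a Lipschitz manifold with ∂(cl U₂) = ∂U₂ ≠ ∅. If ∂U₁ and ∂U₂ are globally isometric in their relative metrics ρ_{∂U₁,U₁} and ρ_{∂U₂,U₂}, then ∂U₁ and ∂U₂ are isometric in the Euclidean metric of ℝⁿ (i.e., there is a Euclidean isometry of ℝⁿ mapping ∂U₁ onto ∂U₂). -/

import Mathlib

open Set Filter Metric Topology ENNReal

noncomputable section

/-- A domain in `ℝⁿ`: a nonempty open connected set. -/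
def IsDomainSet {n : ℕ} (U : Set (EuclideanSpace ℝ (Fin n))) : Prop :=
  IsOpen U ∧ IsConnected U

/-- The infimum of lengths of smooth paths joining `a` and `b` inside `U`. -/
def smoothPathInf {n : ℕ} (U : Set (EuclideanSpace ℝ (Fin n)))
    (a b : EuclideanSpace ℝ (Fin n)) : ℝ≥0∞ :=
  ⨅ (γ : ℝ → EuclideanSpace ℝ (Fin n)) (_ : ContDiff ℝ 1 γ) (_ : γ 0 = a)
    (_ : γ 1 = b) (_ : ∀ t ∈ Icc (0:ℝ) 1, γ t ∈ U), eVariationOn γ (Icc 0 1)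

/-- The relative metric `ρ_{∂U,U}`:
`ρ(x,y) = liminf_{x'→x, y'→y; x',y'∈U} inf{length γ : γ smooth path joining x',y' in U}`. -/
def relDist {n : ℕ} (U : Set (EuclideanSpace ℝ (Fin n)))
    (x y : EuclideanSpace ℝ (Fin n)) : ℝ≥0∞ :=
  Filter.liminf (fun p : EuclideanSpace ℝ (Fin n) × EuclideanSpace ℝ (Fin n) =>
    smoothPathInf U p.1 p.2) ((𝓝[U] x) ×ˢ (𝓝[U] y))

/-- `f` is a bijection of `∂U` onto `∂V` which is a local isometry
in the relative metrics of the boundaries. -/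
def IsBoundaryLocalIsometry {n : ℕ} (U V : Set (EuclideanSpace ℝ (Fin n)))
    (f : EuclideanSpace ℝ (Fin n) → EuclideanSpace ℝ (Fin n)) : Prop :=
  Set.BijOn f (frontier U) (frontier V) ∧
  ∀ y ∈ frontier U, ∃ ε : ℝ≥0∞, 0 < ε ∧ ∀ a ∈ frontier U, ∀ b ∈ frontier U,
    relDist U a y < ε → relDist U b y < ε →
      relDist U a b = relDist V (f a) (f b)

/-- `U` has smooth boundary: `∂U` is an `(n-1)`-dimensional submanifold of
class `C¹` without boundary, i.e. near each of its points the frontier can be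
mapped by a `C¹` diffeomorphism onto an open piece of a hyperplane. -/
def HasC1Boundary {n : ℕ} (U : Set (EuclideanSpace ℝ (Fin n))) : Prop :=
  ∀ x ∈ frontier U, ∃ (W W' : Set (EuclideanSpace ℝ (Fin n)))
    (φ ψ : EuclideanSpace ℝ (Fin n) → EuclideanSpace ℝ (Fin n))
    (ℓ : EuclideanSpace ℝ (Fin n) →L[ℝ] ℝ),
    IsOpen W ∧ x ∈ W ∧ IsOpen W' ∧ ℓ ≠ 0 ∧
    ContDiffOn ℝ 1 φ W ∧ ContDiffOn ℝ 1 ψ W' ∧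
    Set.MapsTo φ W W' ∧ Set.MapsTo ψ W' W ∧
    (∀ z ∈ W, ψ (φ z) = z) ∧ (∀ z ∈ W', φ (ψ z) = z) ∧
    φ '' (W ∩ frontier U) = W' ∩ {y | ℓ y = 0}

/-- The intrinsic distance inside a set `S`: the infimum of lengths of
(continuous) paths joining `a` and `b` inside `S`. -/
def intrinsicDist {n : ℕ} (S : Set (EuclideanSpace ℝ (Fin n)))
    (a b : EuclideanSpace ℝ (Fin n)) : ℝ≥0∞ :=
  ⨅ (γ : ℝ → EuclideanSpace ℝ (Fin n)) (_ : ContinuousOn γ (Icc (0:ℝ) 1))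
    (_ : γ 0 = a) (_ : γ 1 = b) (_ : ∀ t ∈ Icc (0:ℝ) 1, γ t ∈ S),
    eVariationOn γ (Icc 0 1)

/-- A strictly convex domain: convex, and the open segment joining any two
distinct points of its closure is contained in the domain. -/
def IsStrictlyConvexDomain {n : ℕ} (U : Set (EuclideanSpace ℝ (Fin n))) : Prop :=
  Convex ℝ U ∧ ∀ a ∈ closure U, ∀ b ∈ closure U, a ≠ b → openSegment ℝ a b ⊆ U
/-- The closure of `U` is a Lipschitz manifold (with boundary): each of its
points has a neighborhood which a bi-Lipschitz homeomorphism maps so that the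
closure of `U` corresponds to the trace of a (possibly trivial) half-space. -/
def ClosureIsLipschitzManifold {n : ℕ} (U : Set (EuclideanSpace ℝ (Fin n))) : Prop :=
  ∀ x ∈ closure U, ∃ (W W' : Set (EuclideanSpace ℝ (Fin n)))
    (φ ψ : EuclideanSpace ℝ (Fin n) → EuclideanSpace ℝ (Fin n))
    (K K' : NNReal) (ℓ : EuclideanSpace ℝ (Fin n) →L[ℝ] ℝ),
    IsOpen W ∧ x ∈ W ∧ IsOpen W' ∧
    LipschitzOnWith K φ W ∧ LipschitzOnWith K' ψ W' ∧
    Set.MapsTo φ W W' ∧ Set.MapsTo ψ W' W ∧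
    (∀ z ∈ W, ψ (φ z) = z) ∧ (∀ z ∈ W', φ (ψ z) = z) ∧
    φ '' (W ∩ closure U) = W' ∩ {y | ℓ y ≤ 0}


section RelativeMetric

variable {n : ℕ} {U : Set (EuclideanSpace ℝ (Fin n))}

theorem smoothPathInf_le_of_path {γ : ℝ → EuclideanSpace ℝ (Fin n)}
    {a b : EuclideanSpace ℝ (Fin n)} (hγ : ContDiff ℝ 1 γ) (h0 : γ 0 = a) (h1 : γ 1 = b)
    (hU : ∀ t ∈ Icc (0:ℝ) 1, γ t ∈ U) : smoothPathInf U a b ≤ eVariationOn γ (Icc 0 1) :=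
  iInf₂_le_of_le γ hγ <| iInf₂_le_of_le h0 h1 <| iInf_le _ hU

theorem LipschitzOnWith.eVariationOn_Icc_le {γ : ℝ → EuclideanSpace ℝ (Fin n)} {K : NNReal}
    {s t : ℝ} (hK : LipschitzOnWith K γ (Icc s t)) (hst : s ≤ t) :
    eVariationOn γ (Icc s t) ≤ ENNReal.ofReal (K * (t - s)) := by
  have h1 := hK.comp_eVariationOn_le (mapsTo_id (Icc s t))
  have h2 := (monotone_id.monotoneOn (Icc s t)).eVariationOn_eq
    (left_mem_Icc.2 hst) (right_mem_Icc.2 hst)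
  rw [inter_self] at h2
  rw [ENNReal.ofReal_mul K.coe_nonneg]
  simpa [h2] using h1

theorem edist_le_smoothPathInf (U : Set (EuclideanSpace ℝ (Fin n)))
    (a b : EuclideanSpace ℝ (Fin n)) : edist a b ≤ smoothPathInf U a b := by
  simp only [smoothPathInf, le_iInf_iff]
  rintro γ - rfl rfl -
  exact eVariationOn.edist_le γ (by simp) (by simp)

/-- The length of an arc of a `C¹` path bounds `smoothPathInf` between its endpoints. -/
theorem smoothPathInf_le_eVariationOn {γ : ℝ → EuclideanSpace ℝ (Fin n)} (hγ : ContDiff ℝ 1 γ)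
    {s t : ℝ} (hst : s ≤ t) (hU : ∀ r ∈ Icc s t, γ r ∈ U) :
    smoothPathInf U (γ s) (γ t) ≤ eVariationOn γ (Icc s t) := by
  have hmaps : MapsTo (fun r : ℝ => s + r * (t - s)) (Icc 0 1) (Icc s t) := by
    rintro r ⟨h0, h1⟩
    constructor <;> nlinarith
  refine (smoothPathInf_le_of_path (γ := γ ∘ fun r => s + r * (t - s)) (hγ.comp (by fun_prop))
    (by simp) (by simp) fun r hr => hU _ (hmaps hr)).trans ?_
  refine eVariationOn.comp_le_of_monotoneOn _ _ (fun r _ r' _ h => ?_) hmaps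
  have : r * (t - s) ≤ r' * (t - s) := by gcongr
  simpa using this

theorem smoothPathInf_comm_le (a b : EuclideanSpace ℝ (Fin n)) :
    smoothPathInf U b a ≤ smoothPathInf U a b := by
  rw [smoothPathInf.eq_def U a b]
  simp only [le_iInf_iff]
  rintro γ hγ rfl rfl hU
  have hmaps : MapsTo (fun r : ℝ => 1 - r) (Icc 0 1) (Icc 0 1) := by
    rintro r ⟨h0, h1⟩
    constructor <;> linarith
  refine (smoothPathInf_le_of_path (γ := γ ∘ fun r => 1 - r) (hγ.comp (by fun_prop))
    (by simp) (by simp) fun r hr => hU _ (hmaps hr)).trans ?_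
  refine eVariationOn.comp_le_of_antitoneOn _ _ (fun r _ r' _ h => ?_) hmaps
  exact sub_le_sub_left h 1

theorem smoothPathInf_comm (a b : EuclideanSpace ℝ (Fin n)) :
    smoothPathInf U b a = smoothPathInf U a b :=
  le_antisymm (smoothPathInf_comm_le a b) (smoothPathInf_comm_le b a)

theorem smoothPathInf_le_edist {C : Set (EuclideanSpace ℝ (Fin n))} (hC : Convex ℝ C)
    (hCU : C ⊆ U) {a b : EuclideanSpace ℝ (Fin n)} (ha : a ∈ C) (hb : b ∈ C) :
    smoothPathInf U a b ≤ edist a b := by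
  have hL : LipschitzWith (nndist a b) (AffineMap.lineMap a b : ℝ → EuclideanSpace ℝ (Fin n)) :=
    lipschitzWith_lineMap a b
  have hc : ContDiff ℝ 1 (AffineMap.lineMap a b : ℝ → EuclideanSpace ℝ (Fin n)) := by
    have : ⇑(AffineMap.lineMap a b : ℝ →ᵃ[ℝ] EuclideanSpace ℝ (Fin n)) =
        fun t => t • (b - a) + a := by
      ext1 t; simp [AffineMap.lineMap_apply]
    rw [this]; fun_prop
  refine (smoothPathInf_le_of_path hc (by simp) (by simp)
    fun r hr => hCU (hC.lineMap_mem ha hb hr)).trans ?_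
  refine (hL.lipschitzOnWith.eVariationOn_Icc_le zero_le_one).trans_eq ?_
  rw [sub_zero, mul_one, edist_dist, coe_nndist]

theorem smoothPathInf_triangle (a b c : EuclideanSpace ℝ (Fin n)) :
    smoothPathInf U a c ≤ smoothPathInf U a b + smoothPathInf U b c := by
  refine ENNReal.le_of_forall_pos_le_add fun ε hε hfin => ?_
  have hε2 : ((ε / 2 : NNReal) : ℝ≥0∞) ≠ 0 := by simpa using hε.ne'
  have key : ∀ p q : EuclideanSpace ℝ (Fin n), smoothPathInf U p q ≠ ⊤ →
      ∃ γ : ℝ → EuclideanSpace ℝ (Fin n), ContDiff ℝ 1 γ ∧ γ 0 = p ∧ γ 1 = q ∧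
        (∀ t ∈ Icc (0:ℝ) 1, γ t ∈ U) ∧
        eVariationOn γ (Icc 0 1) < smoothPathInf U p q + (ε / 2 : NNReal) := by
    intro p q h
    have := ENNReal.lt_add_right h hε2
    conv_lhs at this => rw [smoothPathInf]
    simpa only [iInf_lt_iff, exists_prop] using this
  obtain ⟨γ₁, c₁, z₁, o₁, u₁, l₁⟩ := key a b (ne_top_of_lt (lt_of_le_of_lt le_self_add hfin))
  obtain ⟨γ₂, c₂, z₂, o₂, u₂, l₂⟩ := key b c (ne_top_of_lt (lt_of_le_of_lt le_add_self hfin))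
  set σ := Real.smoothTransition
  have hσ : ContDiff ℝ 1 σ := Real.smoothTransition.contDiff (n := 1)
  have hσI : ∀ t, σ t ∈ Icc (0:ℝ) 1 := fun t =>
    ⟨Real.smoothTransition.nonneg t, Real.smoothTransition.le_one t⟩
  set η : ℝ → EuclideanSpace ℝ (Fin n) := fun t => γ₁ (σ (2 * t)) + γ₂ (σ (2 * t - 1)) - b
  have hη₁ : EqOn η (γ₁ ∘ fun t => σ (2 * t)) (Icc 0 (1 / 2)) := by
    intro t ht
    have : σ (2 * t - 1) = 0 := Real.smoothTransition.zero_of_nonpos (by linarith [ht.2])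
    simp [η, this, z₂]
  have hη₂ : EqOn η (γ₂ ∘ fun t => σ (2 * t - 1)) (Icc (1 / 2) 1) := by
    intro t ht
    have : σ (2 * t) = 1 := Real.smoothTransition.one_of_one_le (by linarith [ht.1])
    simp [η, this, o₁]
  have hη : ContDiff ℝ 1 η := by
    refine ((c₁.comp (hσ.comp (by fun_prop))).add (c₂.comp (hσ.comp (by fun_prop)))).sub
      contDiff_const
  have e0 : η 0 = a := by
    rw [hη₁ (by norm_num)]; simp [σ, Real.smoothTransition.zero, z₁]
  have e1 : η 1 = c := by
    rw [hη₂ (by norm_num)]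
    have : (2 * 1 - 1 : ℝ) = 1 := by norm_num
    rw [Function.comp_apply, this, show σ 1 = 1 from Real.smoothTransition.one, o₂]
  have hmono : Monotone σ := Real.smoothTransition.monotone
  have hU : ∀ t ∈ Icc (0:ℝ) 1, η t ∈ U := by
    intro t ht
    rcases le_total t (1 / 2) with h | h
    · rw [hη₁ ⟨ht.1, h⟩]; exact u₁ _ (hσI _)
    · rw [hη₂ ⟨h, ht.2⟩]; exact u₂ _ (hσI _)
  have hsplit := eVariationOn.Icc_add_Icc η (s := univ) (a := (0:ℝ)) (b := 1 / 2) (c := 1)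
    (by norm_num) (by norm_num) (mem_univ _)
  simp only [univ_inter] at hsplit
  calc smoothPathInf U a c ≤ eVariationOn η (Icc 0 1) := by
        rw [← e0, ← e1]; exact smoothPathInf_le_eVariationOn hη zero_le_one hU
    _ = eVariationOn η (Icc 0 (1 / 2)) + eVariationOn η (Icc (1 / 2) 1) := hsplit.symm
    _ ≤ eVariationOn γ₁ (Icc 0 1) + eVariationOn γ₂ (Icc 0 1) := by
        rw [eVariationOn.congr hη₁, eVariationOn.congr hη₂]
        gcongr
        · exact eVariationOn.comp_le_of_monotoneOn _ _
            (fun x _ y _ h => hmono (by linarith)) fun t _ => hσI _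
        · exact eVariationOn.comp_le_of_monotoneOn _ _
            (fun x _ y _ h => hmono (by linarith)) fun t _ => hσI _
    _ ≤ (smoothPathInf U a b + (ε / 2 : NNReal)) + (smoothPathInf U b c + (ε / 2 : NNReal)) := by
        gcongr
    _ = smoothPathInf U a b + smoothPathInf U b c + ε := by
        have : (ε : ℝ≥0∞) = (ε / 2 : NNReal) + (ε / 2 : NNReal) := by
          rw [← ENNReal.coe_add, add_halves]
        rw [this]; ring

/-- Points sampled along an almost shortest path, proportionally to arc length. -/
theorem exists_arclength_points {p q : EuclideanSpace ℝ (Fin n)} {L : ℝ}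
    (h : smoothPathInf U p q < ENNReal.ofReal L) :
    ∃ P : ℝ → EuclideanSpace ℝ (Fin n), ∀ s ∈ Icc (0:ℝ) 1, P s ∈ U ∧
      smoothPathInf U p (P s) ≤ ENNReal.ofReal (s * L) ∧
      smoothPathInf U (P s) q ≤ ENNReal.ofReal ((1 - s) * L) ∧
      ∀ t ∈ Icc (0:ℝ) 1, s ≤ t → smoothPathInf U (P s) (P t) ≤ ENNReal.ofReal ((t - s) * L) := by
  simp only [smoothPathInf, iInf_lt_iff] at h
  obtain ⟨γ, hγ, rfl, rfl, hU, hL⟩ := h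
  obtain ⟨K, hK⟩ := (hγ.locallyLipschitz.locallyLipschitzOn
    (s := Icc (0:ℝ) 1)).exists_lipschitzOnWith_of_compact isCompact_Icc
  have hvar : ∀ s t : ℝ, 0 ≤ s → s ≤ t → t ≤ 1 →
      eVariationOn γ (Icc s t) ≤ ENNReal.ofReal (K * (t - s)) := by
    intro s t hs hst ht
    exact (hK.mono (Icc_subset_Icc hs ht)).eVariationOn_Icc_le hst
  set ℓ : ℝ → ℝ := fun t => (eVariationOn γ (Icc 0 t)).toReal with hℓ
  have hfin : ∀ s t : ℝ, 0 ≤ s → s ≤ t → t ≤ 1 → eVariationOn γ (Icc s t) ≠ ⊤ :=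
    fun s t hs hst ht => ne_top_of_le_ne_top ENNReal.ofReal_ne_top (hvar s t hs hst ht)
  have hdiff : ∀ s t : ℝ, 0 ≤ s → s ≤ t → t ≤ 1 →
      eVariationOn γ (Icc s t) = ENNReal.ofReal (ℓ t - ℓ s) := by
    intro s t hs hst ht
    have hsplit := eVariationOn.Icc_add_Icc γ (s := univ) hs hst (mem_univ _)
    simp only [univ_inter] at hsplit
    have : ℓ t = ℓ s + (eVariationOn γ (Icc s t)).toReal := by
      simp only [hℓ]
      rw [← hsplit, ENNReal.toReal_add (hfin 0 s le_rfl hs (hst.trans ht)) (hfin s t hs hst ht)]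
    rw [this, add_sub_cancel_left, ENNReal.ofReal_toReal (hfin s t hs hst ht)]
  have hmono : ∀ s t : ℝ, 0 ≤ s → s ≤ t → t ≤ 1 → ℓ s ≤ ℓ t := by
    intro s t hs hst ht
    exact ENNReal.toReal_mono (hfin 0 t le_rfl (hs.trans hst) ht)
      (eVariationOn.mono _ (Icc_subset_Icc_right hst))
  have hcont : ContinuousOn ℓ (Icc 0 1) := by
    refine LipschitzOnWith.continuousOn (K := K) (LipschitzOnWith.of_le_add_mul K ?_)
    intro s hs t ht
    rcases le_total s t with hst | hst
    · have := hmono s t hs.1 hst ht.2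
      have : 0 ≤ K * dist s t := by positivity
      linarith
    · have h1 := hvar t s ht.1 hst hs.2
      rw [hdiff t s ht.1 hst hs.2, ENNReal.ofReal_le_ofReal_iff
        (mul_nonneg K.coe_nonneg (by linarith))] at h1
      rw [Real.dist_eq, abs_of_nonneg (by linarith)]
      linarith
  have h0 : ℓ 0 = 0 := by simp [hℓ]
  have hlpos : 0 ≤ ℓ 1 := ENNReal.toReal_nonneg
  have hlL : ℓ 1 ≤ L := by
    rw [hdiff 0 1 le_rfl zero_le_one le_rfl, h0, sub_zero] at hL
    exact ((ENNReal.ofReal_lt_ofReal_iff_of_nonneg hlpos).1 hL).le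
  have hτ : ∀ s : ℝ, ∃ τ, s ∈ Icc (0:ℝ) 1 → τ ∈ Icc (0:ℝ) 1 ∧ ℓ τ = s * ℓ 1 := by
    intro s
    by_cases hs : s ∈ Icc (0:ℝ) 1
    · obtain ⟨τ, hτ, hτ'⟩ := intermediate_value_Icc zero_le_one hcont
        (show s * ℓ 1 ∈ Icc (ℓ 0) (ℓ 1) by
          rw [h0]; exact ⟨mul_nonneg hs.1 hlpos, mul_le_of_le_one_left hlpos hs.2⟩)
      exact ⟨τ, fun _ => ⟨hτ, hτ'⟩⟩
    · exact ⟨0, fun h => absurd h hs⟩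
  choose τ hτ using hτ
  have hpath : ∀ u ∈ Icc (0:ℝ) 1, ∀ v ∈ Icc (0:ℝ) 1, u ≤ v →
      smoothPathInf U (γ u) (γ v) ≤ ENNReal.ofReal (ℓ v - ℓ u) := by
    intro u hu v hv huv
    rw [← hdiff u v hu.1 huv hv.2]
    exact smoothPathInf_le_eVariationOn hγ huv fun r hr => hU r ⟨hu.1.trans hr.1, hr.2.trans hv.2⟩
  refine ⟨fun s => γ (τ s), fun s hs => ?_⟩
  obtain ⟨hsI, hsl⟩ := hτ s hs
  refine ⟨hU _ hsI, ?_, ?_, fun t ht hst => ?_⟩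
  · refine (hpath 0 (by simp) _ hsI hsI.1).trans (ENNReal.ofReal_le_ofReal ?_)
    rw [h0, hsl, sub_zero]
    exact mul_le_mul_of_nonneg_left hlL hs.1
  · refine (hpath _ hsI 1 (by simp) hsI.2).trans (ENNReal.ofReal_le_ofReal ?_)
    rw [hsl]
    nlinarith [hs.2]
  · obtain ⟨htI, htl⟩ := hτ t ht
    have hb : (t - s) * ℓ 1 ≤ (t - s) * L := mul_le_mul_of_nonneg_left hlL (by linarith)
    have hb0 : 0 ≤ (t - s) * ℓ 1 := mul_nonneg (by linarith) hlpos
    rcases le_total (τ s) (τ t) with h | h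
    · refine (hpath _ hsI _ htI h).trans (ENNReal.ofReal_le_ofReal ?_)
      rw [hsl, htl]; linarith
    · rw [smoothPathInf_comm]
      refine (hpath _ htI _ hsI h).trans (ENNReal.ofReal_le_ofReal ?_)
      rw [hsl, htl]; linarith

theorem edist_le_relDist (U : Set (EuclideanSpace ℝ (Fin n))) (x y : EuclideanSpace ℝ (Fin n)) :
    edist x y ≤ relDist U x y := by
  refine le_of_forall_lt fun c hc => ?_
  obtain ⟨c', hcc', hc'⟩ := exists_between hc
  refine hcc'.trans_le (le_liminf_of_le (by isBoundedDefault) ?_)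
  have hle : (𝓝[U] x) ×ˢ (𝓝[U] y) ≤ 𝓝 (x, y) := by
    rw [nhds_prod_eq]
    exact Filter.prod_mono nhdsWithin_le_nhds nhdsWithin_le_nhds
  have hev : ∀ᶠ p : EuclideanSpace ℝ (Fin n) × EuclideanSpace ℝ (Fin n) in 𝓝 (x, y),
      c' < edist p.1 p.2 := continuous_edist.continuousAt.eventually (lt_mem_nhds hc')
  filter_upwards [hev.filter_mono hle] with p hp
  exact hp.le.trans (edist_le_smoothPathInf U _ _)

theorem relDist_le_of_tendsto {ι : Type*} {l : Filter ι} [l.NeBot]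
    {x y : EuclideanSpace ℝ (Fin n)} {p q : ι → EuclideanSpace ℝ (Fin n)} {c : ι → ℝ≥0∞}
    {C : ℝ≥0∞} (hp : Tendsto p l (𝓝 x)) (hpU : ∀ i, p i ∈ U) (hq : Tendsto q l (𝓝 y))
    (hqU : ∀ i, q i ∈ U) (hc : Tendsto c l (𝓝 C)) (h : ∀ i, smoothPathInf U (p i) (q i) ≤ c i) :
    relDist U x y ≤ C := by
  have ht : Tendsto (fun i => (p i, q i)) l ((𝓝[U] x) ×ˢ (𝓝[U] y)) :=
    (tendsto_nhdsWithin_iff.2 ⟨hp, .of_forall hpU⟩).prodMk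
      (tendsto_nhdsWithin_iff.2 ⟨hq, .of_forall hqU⟩)
  calc relDist U x y ≤ liminf (fun p : EuclideanSpace ℝ (Fin n) × EuclideanSpace ℝ (Fin n) =>
        smoothPathInf U p.1 p.2) (map (fun i => (p i, q i)) l) := liminf_le_liminf_of_le ht
    _ ≤ liminf c l := liminf_le_liminf (.of_forall h)
    _ = C := hc.liminf_eq

theorem relDist_eq_edist_of_convex (hU : Convex ℝ U) {x y : EuclideanSpace ℝ (Fin n)}
    (hx : x ∈ closure U) (hy : y ∈ closure U) : relDist U x y = edist x y := by
  refine le_antisymm ?_ (edist_le_relDist U x y)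
  obtain ⟨p, hpU, hp⟩ := mem_closure_iff_seq_limit.1 hx
  obtain ⟨q, hqU, hq⟩ := mem_closure_iff_seq_limit.1 hy
  exact relDist_le_of_tendsto hp hpU hq hqU (hp.edist hq)
    fun i => smoothPathInf_le_edist hU subset_rfl (hpU i) (hqU i)

theorem exists_seq_of_relDist {x y : EuclideanSpace ℝ (Fin n)} {d : ℝ} (hd : 0 ≤ d)
    (h : relDist U x y = ENNReal.ofReal d) :
    ∃ (p q : ℕ → EuclideanSpace ℝ (Fin n)) (L : ℕ → ℝ),
      Tendsto p atTop (𝓝 x) ∧ Tendsto q atTop (𝓝 y) ∧ Tendsto L atTop (𝓝 d) ∧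
      ∀ k, p k ∈ U ∧ q k ∈ U ∧ smoothPathInf U (p k) (q k) < ENNReal.ofReal (L k) := by
  set ε : ℕ → ℝ := fun k => 1 / ((k : ℝ) + 1)
  have hε : ∀ k, 0 < ε k := fun k => Nat.one_div_pos_of_nat
  have hε0 : Tendsto ε atTop (𝓝 0) := tendsto_one_div_add_atTop_nhds_zero_nat
  have key : ∀ k, ∃ z : EuclideanSpace ℝ (Fin n) × EuclideanSpace ℝ (Fin n),
      smoothPathInf U z.1 z.2 < ENNReal.ofReal (d + ε k) ∧
      (z.1 ∈ U ∧ dist z.1 x < ε k) ∧ (z.2 ∈ U ∧ dist z.2 y < ε k) := by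
    intro k
    have hlt : relDist U x y < ENNReal.ofReal (d + ε k) := by
      rw [h]
      exact (ENNReal.ofReal_lt_ofReal_iff_of_nonneg hd).2 (lt_add_of_pos_right _ (hε k))
    have hev : ∀ w : EuclideanSpace ℝ (Fin n), ∀ᶠ z in 𝓝[U] w, z ∈ U ∧ dist z w < ε k :=
      fun w => eventually_mem_nhdsWithin.and
        (nhdsWithin_le_nhds (Metric.ball_mem_nhds w (hε k)))
    exact ((frequently_lt_of_liminf_lt (by isBoundedDefault) hlt).and_eventually
      ((hev x).prod_mk (hev y))).exists
  choose z hz using key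
  refine ⟨fun k => (z k).1, fun k => (z k).2, fun k => d + ε k, ?_, ?_, ?_, fun k =>
    ⟨(hz k).2.1.1, (hz k).2.2.1, (hz k).1⟩⟩
  · exact tendsto_iff_dist_tendsto_zero.2 <|
      squeeze_zero (fun _ => dist_nonneg) (fun k => (hz k).2.1.2.le) hε0
  · exact tendsto_iff_dist_tendsto_zero.2 <|
      squeeze_zero (fun _ => dist_nonneg) (fun k => (hz k).2.2.2.le) hε0
  · simpa using hε0.const_add d

/-- A local geodesic of constant speed in Euclidean space is a geodesic. -/
theorem dist_eq_of_locally_dist_eq {E : Type*} [NormedAddCommGroup E] [NormedSpace ℝ E]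
    [StrictConvexSpace ℝ E] {γ : ℝ → E} {d : ℝ}
    (h : ∀ s ∈ Ioo (0:ℝ) 1, ∃ δ > 0, ∀ u ∈ Icc (s - δ) (s + δ), ∀ v ∈ Icc (s - δ) (s + δ),
      u ≤ v → dist (γ u) (γ v) = (v - u) * d) :
    ∀ u ∈ Ioo (0:ℝ) 1, ∀ v ∈ Ioo (0:ℝ) 1, u ≤ v → dist (γ u) (γ v) = (v - u) * d := by
  have haff : ∀ s ∈ Ioo (0:ℝ) 1, ∃ c w : E, γ =ᶠ[𝓝 s] fun t => c + t • w := by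
    intro s hs
    obtain ⟨δ, hδ, H⟩ := h s hs
    have hl : s - δ ∈ Icc (s - δ) (s + δ) := ⟨le_rfl, by linarith⟩
    have hr : s + δ ∈ Icc (s - δ) (s + δ) := ⟨by linarith, le_rfl⟩
    set A := γ (s - δ)
    set B := γ (s + δ)
    refine ⟨A - ((s - δ) / (2 * δ)) • (B - A), (1 / (2 * δ)) • (B - A), ?_⟩
    filter_upwards [Icc_mem_nhds (show s - δ < s by linarith) (show s < s + δ by linarith)]
      with t ht
    have h1 := H _ hl _ hr (by linarith)
    have h2 := H _ hl _ ht ht.1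
    have h3 := H _ ht _ hr ht.2
    have := eq_lineMap_of_dist_eq_mul_of_dist_eq_mul (r := (t - (s - δ)) / (2 * δ))
      (x := A) (y := γ t) (z := B)
      (by rw [h1, h2]; field_simp; ring) (by rw [h1, h3]; field_simp; ring)
    rw [this, AffineMap.lineMap_apply, vsub_eq_sub, vadd_eq_add]
    module
  have hder : ∀ s ∈ Ioo (0:ℝ) 1, DifferentiableAt ℝ γ s ∧
      ∃ w : E, deriv γ =ᶠ[𝓝 s] fun _ => w := by
    intro s hs
    obtain ⟨c, w, hcw⟩ := haff s hs
    have hd : ∀ t : ℝ, HasDerivAt (fun t : ℝ => c + t • w) w t := fun t => by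
      simpa using ((hasDerivAt_id t).smul_const w).const_add c
    refine ⟨((hd s).congr_of_eventuallyEq hcw).differentiableAt, w, ?_⟩
    exact hcw.deriv.trans (.of_forall fun t => (hd t).deriv)
  obtain ⟨w, hw⟩ := isOpen_Ioo.exists_is_const_of_deriv_eq_zero (𝕜 := ℝ) (f := deriv γ)
    isPreconnected_Ioo
    (fun s hs => by
      obtain ⟨-, w, hw⟩ := hder s hs
      exact ((differentiableAt_const w).congr_of_eventuallyEq hw).differentiableWithinAt)
    (fun s hs => by
      obtain ⟨-, w, hw⟩ := hder s hs
      simpa using hw.deriv_eq)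
  have hdw : ∀ t : ℝ, HasDerivAt (fun t : ℝ => t • w) w t := fun t => by
    simpa using (hasDerivAt_id t).smul_const w
  obtain ⟨c, hc⟩ := isOpen_Ioo.exists_eq_add_of_deriv_eq (𝕜 := ℝ) (f := γ)
    (g := fun t => t • w) isPreconnected_Ioo
    (fun s hs => (hder s hs).1.differentiableWithinAt)
    (fun s _ => (hdw s).differentiableAt.differentiableWithinAt)
    (fun s hs => (hw s hs).trans (hdw s).deriv.symm)
  have hdist : ∀ u ∈ Ioo (0:ℝ) 1, ∀ v ∈ Ioo (0:ℝ) 1, u ≤ v →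
      dist (γ u) (γ v) = (v - u) * ‖w‖ := by
    intro u hu v hv huv
    rw [hc hu, hc hv, dist_add_right, dist_comm, dist_eq_norm, ← sub_smul, norm_smul,
      Real.norm_of_nonneg (by linarith)]
  have hwd : ‖w‖ = d := by
    obtain ⟨δ, hδ, H⟩ := h (1 / 2) (by norm_num)
    set δ' := min δ (1 / 4)
    have hδ' : 0 < δ' := by positivity
    have h1 : δ' ≤ δ := min_le_left _ _
    have h2 : δ' ≤ 1 / 4 := min_le_right _ _
    have e := H (1 / 2) ⟨by linarith, by linarith⟩ (1 / 2 + δ')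
      ⟨by linarith, by linarith⟩ (by linarith)
    rw [hdist _ (by norm_num) _ ⟨by linarith, by linarith⟩ (by linarith)] at e
    exact mul_left_cancel₀ (by linarith) e
  rwa [hwd] at hdist

/-- If no boundary point lies strictly between `x` and `y` for the relative metric, then the
relative distance from `x` to `y` is the Euclidean one. -/
theorem relDist_le_dist_of_no_frontier_between (hU : IsOpen U)
    {x y : EuclideanSpace ℝ (Fin n)} {d : ℝ} (hd : 0 < d)
    (h : relDist U x y = ENNReal.ofReal d)
    (H : ∀ z ∈ frontier U, ∀ s ∈ Ioo (0:ℝ) 1, relDist U x z ≤ ENNReal.ofReal (s * d) →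
      ¬ relDist U z y ≤ ENNReal.ofReal ((1 - s) * d)) :
    d ≤ dist x y := by
  obtain ⟨p, q, L, hp, hq, hL, hpq⟩ := exists_seq_of_relDist hd.le h
  choose P hP using fun k => exists_arclength_points (hpq k).2.2
  have hLpos : ∀ k, 0 < L k := fun k => ENNReal.ofReal_pos.1 (bot_le.trans_lt (hpq k).2.2)
  have hdist : ∀ {a b : EuclideanSpace ℝ (Fin n)} {c : ℝ}, 0 ≤ c →
      smoothPathInf U a b ≤ ENNReal.ofReal c → dist a b ≤ c := fun hc hab =>
    (edist_le_ofReal hc).1 ((edist_le_smoothPathInf U _ _).trans hab)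
  set 𝒰 : Ultrafilter ℕ := hyperfilter ℕ
  have h𝒰 : (𝒰 : Filter ℕ) ≤ atTop := Nat.hyperfilter_le_atTop
  replace hp := hp.mono_left h𝒰
  replace hq := hq.mono_left h𝒰
  replace hL := hL.mono_left h𝒰
  have hlim : ∀ s : ℝ, ∃ g, s ∈ Icc (0:ℝ) 1 → Tendsto (fun k => P k s) 𝒰 (𝓝 g) := by
    intro s
    by_cases hs : s ∈ Icc (0:ℝ) 1
    · obtain ⟨g, -, hg⟩ := (isCompact_closedBall x (d + 2)).ultrafilter_le_nhds
        (𝒰.map fun k => P k s) (by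
          rw [le_principal_iff, Ultrafilter.mem_coe, Ultrafilter.mem_map]
          have h1 : ∀ᶠ k in (𝒰 : Filter ℕ), dist (p k) x < 1 :=
            hp.eventually (Metric.ball_mem_nhds x one_pos)
          have h2 : ∀ᶠ k in (𝒰 : Filter ℕ), L k < d + 1 :=
            hL.eventually (gt_mem_nhds (by linarith))
          filter_upwards [h1, h2] with k h1 h2
          have h3 := hdist (mul_nonneg hs.1 (hLpos k).le) (hP k s hs).2.1
          have h4 : s * L k ≤ L k := mul_le_of_le_one_left (hLpos k).le hs.2
          rw [mem_preimage, mem_closedBall]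
          have := dist_triangle_left (P k s) x (p k)
          linarith)
      exact ⟨g, fun _ => hg⟩
    · exact ⟨x, fun h => absurd h hs⟩
  choose γ hγ using hlim
  have hIoo : ∀ {s : ℝ}, s ∈ Ioo (0:ℝ) 1 → s ∈ Icc (0:ℝ) 1 := fun hs => Ioo_subset_Icc_self hs
  have hleft : ∀ s ∈ Ioo (0:ℝ) 1, dist x (γ s) ≤ s * d := fun s hs =>
    le_of_tendsto_of_tendsto' (hp.dist (hγ s (hIoo hs))) (hL.const_mul s) fun k =>
      hdist (mul_nonneg hs.1.le (hLpos k).le) (hP k s (hIoo hs)).2.1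
  have hright : ∀ s ∈ Ioo (0:ℝ) 1, dist (γ s) y ≤ (1 - s) * d := fun s hs =>
    le_of_tendsto_of_tendsto' ((hγ s (hIoo hs)).dist hq) (hL.const_mul (1 - s)) fun k =>
      hdist (mul_nonneg (sub_nonneg.2 hs.2.le) (hLpos k).le) (hP k s (hIoo hs)).2.2.1
  have hmid : ∀ s ∈ Ioo (0:ℝ) 1, ∀ t ∈ Ioo (0:ℝ) 1, s ≤ t →
      dist (γ s) (γ t) ≤ (t - s) * d := fun s hs t ht hst =>
    le_of_tendsto_of_tendsto' ((hγ s (hIoo hs)).dist (hγ t (hIoo ht))) (hL.const_mul (t - s))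
      fun k => hdist (mul_nonneg (sub_nonneg.2 hst) (hLpos k).le)
        ((hP k s (hIoo hs)).2.2.2 t (hIoo ht) hst)
  have hγU : ∀ s ∈ Ioo (0:ℝ) 1, γ s ∈ U := by
    intro s hs
    by_contra hsU
    have hPU : ∀ k, P k s ∈ U := fun k => (hP k s (hIoo hs)).1
    have hfr : γ s ∈ frontier U := by
      rw [hU.frontier_eq]
      exact ⟨mem_closure_of_tendsto (hγ s (hIoo hs)) (.of_forall hPU), hsU⟩
    refine H _ hfr s hs ?_ ?_
    · exact relDist_le_of_tendsto hp (fun k => (hpq k).1) (hγ s (hIoo hs)) hPU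
        (ENNReal.tendsto_ofReal (hL.const_mul s)) fun k => (hP k s (hIoo hs)).2.1
    · exact relDist_le_of_tendsto (hγ s (hIoo hs)) hPU hq (fun k => (hpq k).2.1)
        (ENNReal.tendsto_ofReal (hL.const_mul (1 - s))) fun k => (hP k s (hIoo hs)).2.2.1
  have hshort : ∀ (c : EuclideanSpace ℝ (Fin n)) (r : ℝ), ball c r ⊆ U →
      ∀ s ∈ Ioo (0:ℝ) 1, ∀ t ∈ Ioo (0:ℝ) 1, γ s ∈ ball c r → γ t ∈ ball c r →
      (t - s) * d ≤ dist (γ s) (γ t) := by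
    intro c r hr s hs t ht hsb htb
    have hev : ∀ᶠ k in (𝒰 : Filter ℕ), P k s ∈ ball c r ∧ P k t ∈ ball c r :=
      ((hγ s (hIoo hs)).eventually (isOpen_ball.mem_nhds hsb)).and
        ((hγ t (hIoo ht)).eventually (isOpen_ball.mem_nhds htb))
    have hle : relDist U x y ≤
        ENNReal.ofReal (s * d) + edist (γ s) (γ t) + ENNReal.ofReal ((1 - t) * d) := by
      have htend : Tendsto (fun k => ENNReal.ofReal (s * L k) + smoothPathInf U (P k s) (P k t) +
          ENNReal.ofReal ((1 - t) * L k)) 𝒰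
          (𝓝 (ENNReal.ofReal (s * d) + edist (γ s) (γ t) + ENNReal.ofReal ((1 - t) * d))) := by
        refine ((ENNReal.tendsto_ofReal (hL.const_mul s)).add ?_).add
          (ENNReal.tendsto_ofReal (hL.const_mul (1 - t)))
        refine ((hγ s (hIoo hs)).edist (hγ t (hIoo ht))).congr' ?_
        filter_upwards [hev] with k hk
        exact le_antisymm (edist_le_smoothPathInf U _ _)
          (smoothPathInf_le_edist (convex_ball c r) hr hk.1 hk.2)
      refine relDist_le_of_tendsto hp (fun k => (hpq k).1) hq (fun k => (hpq k).2.1) htend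
        fun k => ?_
      refine (smoothPathInf_triangle _ (P k t) _).trans (add_le_add
        ((smoothPathInf_triangle _ (P k s) _).trans (add_le_add ?_ le_rfl)) ?_)
      · exact (hP k s (hIoo hs)).2.1
      · exact (hP k t (hIoo ht)).2.2.1
    have h1 : 0 ≤ s * d := mul_nonneg hs.1.le hd.le
    have h2 : 0 ≤ (1 - t) * d := mul_nonneg (sub_nonneg.2 ht.2.le) hd.le
    rw [h, edist_dist, ← ENNReal.ofReal_add h1 dist_nonneg,
      ← ENNReal.ofReal_add (by positivity) h2, ENNReal.ofReal_le_ofReal_iff (by positivity)] at hle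
    linarith
  have hgeo : ∀ u ∈ Ioo (0:ℝ) 1, ∀ v ∈ Ioo (0:ℝ) 1, u ≤ v →
      dist (γ u) (γ v) = (v - u) * d := by
    refine dist_eq_of_locally_dist_eq fun s hs => ?_
    obtain ⟨r, hr, hrU⟩ := Metric.isOpen_iff.1 hU _ (hγU s hs)
    obtain ⟨δ, hδ, hδ0, hδ1, hδr⟩ : ∃ δ : ℝ, 0 < δ ∧ δ < s ∧ δ < 1 - s ∧ δ * d < r := by
      have hs1 : 0 < 1 - s := sub_pos.2 hs.2
      have hs0 := hs.1
      have hrd : 0 < r / d := by positivity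
      obtain ⟨δ, hδ, hlt⟩ := exists_between (lt_min hs0 (lt_min hs1 hrd))
      rw [lt_min_iff, lt_min_iff, lt_div_iff₀ hd] at hlt
      exact ⟨δ, hδ, hlt⟩
    have hin : ∀ u ∈ Icc (s - δ) (s + δ), u ∈ Ioo (0:ℝ) 1 := fun u hu =>
      ⟨by linarith [hu.1], by linarith [hu.2]⟩
    have hball : ∀ u ∈ Icc (s - δ) (s + δ), γ u ∈ ball (γ s) r := by
      intro u hu
      rw [mem_ball]
      rcases le_total u s with hus | hus
      · have := hmid u (hin u hu) s hs hus
        have : (s - u) * d ≤ δ * d := mul_le_mul_of_nonneg_right (by linarith [hu.1]) hd.le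
        linarith
      · have := hmid s hs u (hin u hu) hus
        rw [dist_comm] at this
        have : (u - s) * d ≤ δ * d := mul_le_mul_of_nonneg_right (by linarith [hu.2]) hd.le
        linarith
    exact ⟨δ, hδ, fun u hu v hv huv => le_antisymm (hmid u (hin u hu) v (hin v hv) huv)
      (hshort _ r hrU u (hin u hu) v (hin v hv) (hball u hu) (hball v hv))⟩
  refine le_of_forall_pos_le_add fun ε hε => ?_
  obtain ⟨s, hs0, hs⟩ := exists_between (lt_min (show (0:ℝ) < 1 / 2 by norm_num)
    (show 0 < ε / (4 * d) by positivity))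
  rw [lt_min_iff] at hs
  have hsε := (lt_div_iff₀ (show 0 < 4 * d by positivity)).1 hs.2
  have hsI : s ∈ Ioo (0:ℝ) 1 := ⟨hs0, by linarith⟩
  have hsI' : 1 - s ∈ Ioo (0:ℝ) 1 := ⟨by linarith, by linarith⟩
  have h1 := hgeo s hsI (1 - s) hsI' (by linarith)
  have h2 := hleft s hsI
  have h3 := hright (1 - s) hsI'
  have h4 := dist_triangle4 (γ s) x y (γ (1 - s))
  rw [dist_comm (γ s) x, dist_comm y] at h4
  nlinarith

/-- An isometric map defined on a subset of a finite-dimensional inner product space extends to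
an isometry of the whole space. -/
theorem exists_isometryEquiv_eqOn {E : Type*} [NormedAddCommGroup E] [InnerProductSpace ℝ E]
    [FiniteDimensional ℝ E] {A : Set E} {f : E → E}
    (hf : ∀ a ∈ A, ∀ b ∈ A, dist (f a) (f b) = dist a b) : ∃ J : E ≃ᵢ E, EqOn J f A := by
  rcases A.eq_empty_or_nonempty with rfl | ⟨o, ho⟩
  · exact ⟨.refl E, eqOn_empty _ _⟩
  have hinner : ∀ a b : A, inner ℝ (f a - f o) (f b - f o) = inner ℝ (a - o : E) (b - o) := by
    intro a b
    have key : ∀ u v : E, inner ℝ u v = (‖u‖ * ‖u‖ + ‖v‖ * ‖v‖ - ‖u - v‖ * ‖u - v‖) / 2 :=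
      real_inner_eq_norm_mul_self_add_norm_mul_self_sub_norm_sub_mul_self_div_two
    rw [key, key, sub_sub_sub_cancel_right, sub_sub_sub_cancel_right]
    simp only [← dist_eq_norm]
    rw [hf a a.2 o ho, hf b b.2 o ho, hf a a.2 b b.2]
  set T : (A →₀ ℝ) →ₗ[ℝ] E := Finsupp.linearCombination ℝ fun a : A => (a - o : E)
  set S : (A →₀ ℝ) →ₗ[ℝ] E := Finsupp.linearCombination ℝ fun a : A => f a - f o
  have hnorm : ∀ c, ‖S c‖ = ‖T c‖ := by
    intro c
    have : inner ℝ (S c) (S c) = inner ℝ (T c) (T c) := by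
      simp only [S, T, Finsupp.linearCombination_apply, Finsupp.sum, sum_inner, inner_sum,
        real_inner_smul_left, real_inner_smul_right, hinner]
    rw [real_inner_self_eq_norm_sq, real_inner_self_eq_norm_sq] at this
    exact (sq_eq_sq₀ (norm_nonneg _) (norm_nonneg _)).1 this
  have hker : LinearMap.ker T ≤ LinearMap.ker S := by
    intro c hc
    rw [LinearMap.mem_ker] at hc ⊢
    rw [← norm_eq_zero, hnorm, hc, norm_zero]
  set R : LinearMap.range T →ₗ[ℝ] E :=
    (LinearMap.ker T).liftQ S hker ∘ₗ T.quotKerEquivRange.symm.toLinearMap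
  have hR : ∀ c, R ⟨T c, LinearMap.mem_range_self T c⟩ = S c := by
    intro c
    have : T.quotKerEquivRange.symm ⟨T c, LinearMap.mem_range_self T c⟩ =
        (LinearMap.ker T).mkQ c := T.quotKerEquivRange_symm_apply_image c _
    simp only [R, LinearMap.comp_apply, LinearEquiv.coe_coe, this]
    exact Submodule.liftQ_apply _ _ _
  set I : LinearMap.range T →ₗᵢ[ℝ] E := ⟨R, by
    rintro ⟨_, c, rfl⟩
    rw [hR, hnorm]; rfl⟩
  set J₀ : E ≃ₗᵢ[ℝ] E := I.extend.toLinearIsometryEquiv rfl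
  refine ⟨(IsometryEquiv.subRight o).trans (J₀.toIsometryEquiv.trans (IsometryEquiv.addRight (f o))),
    fun a ha => ?_⟩
  have hT : T (Finsupp.single ⟨a, ha⟩ 1) = a - o := by simp [T]
  have hS : S (Finsupp.single ⟨a, ha⟩ 1) = f a - f o := by simp [S]
  have hJ : J₀ (a - o) = f a - f o := by
    rw [← hT, ← hS, ← hR]
    exact LinearIsometry.extend_apply I ⟨_, _⟩
  simp [hJ]

end RelativeMetric

/-- A. D. Aleksandrov's theorem. If `U₁` is a strictly convex
domain in `ℝⁿ` (`n ≥ 2`) and `U₂` is any domain whose closure is a Lipschitz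
manifold with `∂(cl U₂) = ∂U₂ ≠ ∅`, and if `∂U₁` and `∂U₂` are globally
isometric in their relative metrics, then `∂U₁` and `∂U₂` are isometric in the
Euclidean metric of `ℝⁿ`. -/
theorem aleksandrov_strictly_convex_global_isometry
    (n : ℕ) (hn : 2 ≤ n)
    (U₁ U₂ : Set (EuclideanSpace ℝ (Fin n)))
    (hU₁ : IsDomainSet U₁) (hU₁conv : IsStrictlyConvexDomain U₁)
    (hU₂ : IsDomainSet U₂) (hU₂cl : ClosureIsLipschitzManifold U₂)
    (hfr : frontier (closure U₂) = frontier U₂) (hfrne : frontier U₂ ≠ ∅)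
    (f : EuclideanSpace ℝ (Fin n) → EuclideanSpace ℝ (Fin n))
    (hbij : Set.BijOn f (frontier U₁) (frontier U₂))
    (hiso : ∀ a ∈ frontier U₁, ∀ b ∈ frontier U₁,
      relDist U₁ a b = relDist U₂ (f a) (f b)) :
    ∃ J : EuclideanSpace ℝ (Fin n) ≃ᵢ EuclideanSpace ℝ (Fin n),
      J '' frontier U₁ = frontier U₂ := by
  have hfdist : ∀ a ∈ frontier U₁, ∀ b ∈ frontier U₁, dist (f a) (f b) = dist a b := by
    intro a ha b hb
    rcases eq_or_ne a b with rfl | hab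
    · simp
    have hcl : frontier U₁ ⊆ closure U₁ := frontier_subset_closure
    have hrel : ∀ p ∈ frontier U₁, ∀ q ∈ frontier U₁,
        relDist U₂ (f p) (f q) = ENNReal.ofReal (dist p q) := fun p hp q hq => by
      rw [← hiso p hp q hq, relDist_eq_edist_of_convex hU₁conv.1 (hcl hp) (hcl hq), edist_dist]
    have hd : 0 < dist a b := dist_pos.2 hab
    refine le_antisymm ?_ ?_
    · rw [← edist_le_ofReal dist_nonneg, ← hrel a ha b hb]
      exact edist_le_relDist U₂ _ _
    refine relDist_le_dist_of_no_frontier_between hU₂.1 hd (hrel a ha b hb) ?_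
    intro z hz s hs h1 h2
    obtain ⟨c, hc, rfl⟩ := hbij.surjOn hz
    rw [hrel a ha c hc, ENNReal.ofReal_le_ofReal_iff (mul_nonneg hs.1.le hd.le)] at h1
    rw [hrel c hc b hb, ENNReal.ofReal_le_ofReal_iff
      (mul_nonneg (sub_nonneg.2 hs.2.le) hd.le)] at h2
    have htri := dist_triangle a c b
    have hcs : c = AffineMap.lineMap a b s :=
      eq_lineMap_of_dist_eq_mul_of_dist_eq_mul (by linarith) (by linarith)
    have hcU : c ∈ U₁ := by
      apply hU₁conv.2 a (hcl ha) b (hcl hb) hab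
      rw [openSegment_eq_image_lineMap, hcs]
      exact mem_image_of_mem _ hs
    rw [hU₁.1.frontier_eq] at hc
    exact hc.2 hcU
  obtain ⟨J, hJ⟩ := exists_isometryEquiv_eqOn hfdist
  exact ⟨J, hJ.image_eq.trans hbij.image_eq⟩

end
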